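/- arXiv:1906.01687 — 4 statements merged into one kernel-verified Lean document; each statement's English description precedes it below -/
import Mathlib

section
/- Let Ω be a finite nonempty type with cardinality m, let s be a positive natural number, and let y : Ω → ℝ. Under the uniform distribution on ω : Fin s → Ω, define the stochastic tensor entries ỹ_i(ω) = c_i(ω) · (m / s) · y_i, where c_i(ω) = card { j : Fin s | ω j = i }. Then for every i ∈ Ω, E[ỹ_i] = y_i; i.e., the uniformly sampled stochastic tensor is an entrywise unbiased estimator of y. -/
/-- For each coordinate `j`, the functions taking the value `a` at `j` make up the fraction
`1 / card α` of all functions. -/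
theorem card_mul_card_filter_apply_eq {ι α : Type*} [Fintype ι] [DecidableEq ι] [Fintype α]
    [DecidableEq α] (j : ι) (a : α) :
    Fintype.card α * (Finset.univ.filter fun f : ι → α => f j = a).card =
      Fintype.card (ι → α) := by
  have h := Fintype.card_filter_piFinset_const_eq_of_mem (Finset.univ : Finset α) j
    (Finset.mem_univ a)
  rw [Fintype.piFinset_univ, Finset.card_univ] at h
  have : Nonempty ι := ⟨j⟩
  rw [h, Fintype.card_fun, mul_pow_sub_one Fintype.card_ne_zero]

/-- The total number of occurrences of the value `a`, over all functions `ι → α`. -/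
theorem card_mul_sum_card_filter_eq {ι α : Type*} [Fintype ι] [DecidableEq ι] [Fintype α]
    [DecidableEq α] (a : α) :
    Fintype.card α * ∑ f : ι → α, (Finset.univ.filter fun j => f j = a).card =
      Fintype.card ι * Fintype.card (ι → α) := by
  simp_rw [Finset.card_filter]
  rw [Finset.sum_comm, Finset.mul_sum]
  simp_rw [← Finset.card_filter, card_mul_card_filter_apply_eq]
  rw [Finset.sum_const, Finset.card_univ, smul_eq_mul]

/-- Under uniform sampling of `s` indices with replacement from a finite nonempty
set `Ω` of cardinality `m`, the stochastic tensor with entries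
`ỹ_i(ω) = c_i(ω) · (m / s) · y_i`, where `c_i(ω) = card {j | ω j = i}`,
is an entrywise unbiased estimator of `y`: `E[ỹ_i] = y_i`. -/
theorem uniform_sampling_unbiased
    {Ω : Type*} [Fintype Ω] [Nonempty Ω] [DecidableEq Ω]
    (m : ℕ) (hm : Fintype.card Ω = m)
    (s : ℕ) (hs : 0 < s) (y : Ω → ℝ) (i : Ω) :
    ((Fintype.card (Fin s → Ω) : ℝ))⁻¹ *
      ∑ ω : Fin s → Ω,
        (((Finset.univ.filter fun j : Fin s => ω j = i).card : ℝ) * ((m : ℝ) / (s : ℝ)) * y i)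
    = y i := by
  subst hm
  have h : (Fintype.card Ω : ℝ) *
      ∑ ω : Fin s → Ω, ((Finset.univ.filter fun j : Fin s => ω j = i).card : ℝ) =
        s * (Fintype.card (Fin s → Ω) : ℝ) := by
    have := card_mul_sum_card_filter_eq (ι := Fin s) i
    rw [Fintype.card_fin] at this
    exact_mod_cast this
  have hs' : (s : ℝ) ≠ 0 := Nat.cast_ne_zero.mpr hs.ne'
  have hN : (Fintype.card (Fin s → Ω) : ℝ) ≠ 0 := Nat.cast_ne_zero.mpr Fintype.card_ne_zero
  rw [← Finset.sum_mul, ← Finset.sum_mul]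
  field_simp
  linear_combination y i * h
end

section
/- Let Ω be a finite nonempty type with cardinality N, and let nz : Ω → Prop be a decidable predicate (marking the nonzero indices) whose subtype Nz = { i : Ω // nz i } is nonempty with cardinality η. Let p and q be positive natural numbers, and model semi-stratified sampling by the uniform distribution on (Fin p → Nz) × (Fin q → Ω) (p i.i.d. uniform draws of nonzero indices and q i.i.d. uniform draws from all of Ω, independent of each other). Let y, c : Ω → ℝ be functions such that c_i = y_i whenever ¬ nz i. For (σ, τ) in the sample space define ñ_i = card { j : Fin p | (σ j : Ω) = i } and z̃_i = card { j : Fin q | τ j = i }, and the stochastic tensor entry ỹ_i = ñ_i · (η / p) · (y_i − c_i) + z̃_i · (N / q) · c_i. Then E[ỹ_i] = y_i for every i ∈ Ω (both when nz i holds and when it fails); i.e., the semi-stratified stochastic tensor is an entrywise unbiased estimator of y. -/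
theorem card_mul_sum_apply {ι α : Type*} [Fintype ι] [DecidableEq ι] [Fintype α]
    (j : ι) (g : α → ℝ) :
    (Fintype.card α : ℝ) * ∑ f : ι → α, g (f j) =
      (Fintype.card (ι → α) : ℝ) * ∑ a, g a := by
  have hsum : ∑ f : ι → α, g (f j) = ∑ x : α × ({k // k ≠ j} → α), g x.1 :=
    Fintype.sum_equiv (Equiv.funSplitAt j α) _ _ fun f => rfl
  rw [hsum, Fintype.card_congr (Equiv.funSplitAt j α), Fintype.card_prod,
    Fintype.sum_prod_type]
  simp only [Finset.sum_const, Finset.card_univ, nsmul_eq_mul, ← Finset.mul_sum]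
  push_cast
  ring

/-- The expected number of draws satisfying `P`, with denominators cleared. -/
theorem card_mul_sum_card_filter {ι α : Type*} [Fintype ι] [DecidableEq ι] [Fintype α]
    (P : α → Prop) [DecidablePred P] :
    (Fintype.card α : ℝ) * ∑ f : ι → α, ((Finset.univ.filter fun j => P (f j)).card : ℝ) =
      (Fintype.card (ι → α) : ℝ) * (Fintype.card ι * (Finset.univ.filter P).card) := by
  simp only [Finset.card_filter, Nat.cast_sum]
  rw [Finset.sum_comm, Finset.mul_sum]
  simp only [card_mul_sum_apply _ fun a => ((if P a then 1 else 0 : ℕ) : ℝ)]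
  rw [Finset.sum_const, Finset.card_univ, nsmul_eq_mul]
  ring

/-- Semi-stratified sampling: from a finite nonempty index set `Ω` (card `N`)
with nonempty set of nonzero indices `Nz = {i // nz i}` (card `η`), one draws
`p` nonzeros i.i.d. uniformly from `Nz` and `q` "zeros" i.i.d. uniformly from
all of `Ω`, independently, modeled by the uniform distribution on
`(Fin p → Nz) × (Fin q → Ω)`.  If `c_i = y_i` whenever `¬ nz i`, then the
stochastic tensor with entries
`ỹ_i = ñ_i · (η/p) · (y_i − c_i) + z̃_i · (N/q) · c_i`
is an entrywise unbiased estimator of `y`. -/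
theorem semi_stratified_sampling_unbiased
    {Ω : Type*} [Fintype Ω] [Nonempty Ω] [DecidableEq Ω]
    (N : ℕ) (hN : Fintype.card Ω = N)
    (nz : Ω → Prop) [DecidablePred nz] [Nonempty {i : Ω // nz i}]
    (η : ℕ) (hη : Fintype.card {i : Ω // nz i} = η)
    (p q : ℕ) (hp : 0 < p) (hq : 0 < q)
    (y c : Ω → ℝ) (hc : ∀ i : Ω, ¬ nz i → c i = y i)
    (i : Ω) :
    ((Fintype.card ((Fin p → {i : Ω // nz i}) × (Fin q → Ω)) : ℝ))⁻¹ *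
      ∑ στ : (Fin p → {i : Ω // nz i}) × (Fin q → Ω),
        (((Finset.univ.filter fun j : Fin p => (στ.1 j : Ω) = i).card : ℝ) *
            ((η : ℝ) / (p : ℝ)) * (y i - c i)
          + ((Finset.univ.filter fun j : Fin q => στ.2 j = i).card : ℝ) *
            ((N : ℝ) / (q : ℝ)) * c i)
    = y i := by
  subst hN hη
  have hA := card_mul_sum_card_filter (ι := Fin p) fun a : {i : Ω // nz i} => (a : Ω) = i
  have hB := card_mul_sum_card_filter (ι := Fin q) fun a : Ω => a = i
  have hone : ((Finset.univ.filter fun a : Ω => a = i).card : ℝ) = 1 := by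
    simp [Finset.filter_eq']
  have hnz : ((Finset.univ.filter fun a : {i : Ω // nz i} => (a : Ω) = i).card : ℝ) *
      (y i - c i) = y i - c i := by
    by_cases h : nz i
    · have : (Finset.univ.filter fun a : {i : Ω // nz i} => (a : Ω) = i) = {⟨i, h⟩} := by
        ext a
        simp [Subtype.ext_iff]
      simp [this]
    · simp [hc i h]
  have hp' : (p : ℝ) ≠ 0 := by positivity
  have hq' : (q : ℝ) ≠ 0 := by positivity
  have hF : (Fintype.card (Fin p → {i : Ω // nz i}) : ℝ) ≠ 0 :=
    Nat.cast_ne_zero.2 Fintype.card_ne_zero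
  have hG : (Fintype.card (Fin q → Ω) : ℝ) ≠ 0 := Nat.cast_ne_zero.2 Fintype.card_ne_zero
  rw [hone, mul_one] at hB
  rw [Fintype.card_prod, Fintype.sum_prod_type]
  simp only [Finset.sum_add_distrib, Finset.sum_const, Finset.card_univ, nsmul_eq_mul,
    ← Finset.sum_mul, ← Finset.mul_sum, Nat.cast_mul]
  rw [Fintype.card_fin] at hA hB
  generalize (Fintype.card (Fin p → {i : Ω // nz i}) : ℝ) = F at *
  generalize (Fintype.card (Fin q → Ω) : ℝ) = G at *
  field_simp
  linear_combination q * G * (y i - c i) * hA + p * F * c i * hB + p * q * F * G * hnz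
end

section
/- Let Nz and Z be finite nonempty types whose disjoint union (sigma/sum type) is Ω, with cardinalities η and ζ respectively, let p and q be positive natural numbers, and let g : Ω → ℝ. Under the uniform distribution on (Fin p → Nz) × (Fin q → Z) (independent i.i.d. uniform draws from each part), define the stratified estimated objective F̂(σ, τ) = (η / p) · ∑_{j : Fin p} g(σ j) + (ζ / q) · ∑_{j : Fin q} g(τ j). Then E[F̂] = ∑_{i ∈ Ω} g(i); i.e., the stratified function estimate is an unbiased estimator of the full objective. -/
/-- Summed over all `n`-tuples of elements of `α`, the scaled sample sum
`(card α / n) · ∑ j, f (σ j)` gives the full sum of `f`, once for each tuple. -/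
theorem sum_scaled_sample_sum {α : Type*} [Fintype α] [Nonempty α] {n : ℕ} (hn : 0 < n)
    (f : α → ℝ) :
    ∑ σ : Fin n → α, (Fintype.card α / n : ℝ) * ∑ j, f (σ j)
      = (Fintype.card (Fin n → α) : ℝ) * ∑ a, f a := by
  have coordinate_sum (j : Fin n) :
      ∑ σ : Fin n → α, f (σ j) = (Fintype.card α : ℝ) ^ (n - 1) * ∑ a, f a := by
    simpa using Fintype.sum_piFinset_apply f Finset.univ j
  have hn' : (n : ℝ) ≠ 0 := by positivity
  rw [← Finset.mul_sum, Finset.sum_comm]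
  simp only [coordinate_sum, Finset.sum_const, Finset.card_univ, Fintype.card_fin, nsmul_eq_mul,
    Fintype.card_fun, Nat.cast_pow]
  rw [← mul_pow_sub_one hn.ne' (Fintype.card α : ℝ)]
  field_simp

/-- Stratified function estimation: the index set `Ω = Nz ⊕ Z` is the disjoint
union of the nonzero indices `Nz` (card `η`) and the zero indices `Z` (card `ζ`).
Drawing `p` indices i.i.d. uniformly from `Nz` and `q` indices i.i.d. uniformly
from `Z`, independently, the stratified estimate
`F̂(σ, τ) = (η/p) · ∑_j g(σ j) + (ζ/q) · ∑_j g(τ j)`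
is an unbiased estimator of the full objective `∑_{i ∈ Ω} g(i)`. -/
theorem stratified_function_estimate_unbiased
    {Nz Z : Type*} [Fintype Nz] [Nonempty Nz] [Fintype Z] [Nonempty Z]
    (η ζ : ℕ) (hη : Fintype.card Nz = η) (hζ : Fintype.card Z = ζ)
    (p q : ℕ) (hp : 0 < p) (hq : 0 < q)
    (g : Nz ⊕ Z → ℝ) :
    ((Fintype.card ((Fin p → Nz) × (Fin q → Z)) : ℝ))⁻¹ *
      ∑ στ : (Fin p → Nz) × (Fin q → Z),
        (((η : ℝ) / (p : ℝ)) * ∑ j : Fin p, g (Sum.inl (στ.1 j))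
          + ((ζ : ℝ) / (q : ℝ)) * ∑ j : Fin q, g (Sum.inr (στ.2 j)))
    = ∑ i : Nz ⊕ Z, g i := by
  subst hη hζ
  rw [Finset.sum_add_distrib, Fintype.sum_prod_type, Fintype.sum_prod_type_right,
    Fintype.sum_sum_type]
  simp only [Finset.sum_const, Finset.card_univ, nsmul_eq_mul]
  rw [← Finset.mul_sum, sum_scaled_sample_sum hp fun a => g (Sum.inl a), ← Finset.mul_sum,
    sum_scaled_sample_sum hq fun a => g (Sum.inr a), Fintype.card_prod, Nat.cast_mul]
  have card_left_ne : (Fintype.card (Fin p → Nz) : ℝ) ≠ 0 := by positivity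
  have card_right_ne : (Fintype.card (Fin q → Z) : ℝ) ≠ 0 := by positivity
  field_simp
end

section
/- Let d ≥ 1, let n : Fin d → ℕ be dimensions with n k ≥ 1, let r ≥ 1 be the rank, and let Ω = Π k : Fin d, Fin (n k) be the index set. Given factor matrices A k : Fin (n k) → Fin r → ℝ, define the model entries m(i) = ∑_{j : Fin r} ∏_{k : Fin d} A k (i k) j for i ∈ Ω, and given data x : Ω → ℝ and an elementwise loss f : ℝ → ℝ → ℝ such that for each i ∈ Ω the map u ↦ f (x i) u has derivative g(i) at the point m(i), define F(A) = ∑_{i ∈ Ω} f (x i) (m(i)). Fix a mode k, a row a : Fin (n k), and a column j₀ : Fin r, and let φ(t) be the value of F when the single entry A k a j₀ is replaced by t (all other entries fixed). Then φ has derivative at t = A k a j₀ equal to ∑_{i ∈ Ω, i k = a} g(i) · ∏_{k' ≠ k} A k' (i k') j₀. (This is the entrywise form of the GCP gradient G_k = Y_(k) Z_k, where Y has entries y_i = ∂f/∂m(x_i, m_i) and Z_k is the Khatri–Rao product of the factor matrices other than A_k.) -/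
/-- Replacing a single factor-matrix entry changes a model entry affinely. -/
theorem sum_prod_update_entry {ι κ R : Type*} [Fintype ι] [DecidableEq ι] [Fintype κ]
    [DecidableEq κ] [CommRing R] {α : ι → Type*} [∀ k, DecidableEq (α k)]
    (A : ∀ k : ι, α k → κ → R) (i : ∀ k, α k) (k : ι) (a : α k) (j₀ : κ) (t : R) :
    ∑ j, ∏ k', Function.update A k
        (Function.update (A k) a (Function.update (A k a) j₀ t)) k' (i k') j =
      ∑ j, ∏ k', A k' (i k') j +
        if i k = a then (t - A k a j₀) * ∏ k' ∈ Finset.univ.erase k, A k' (i k') j₀ else 0 := by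
  have hprod (j : κ) :
      ∏ k', Function.update A k
          (Function.update (A k) a (Function.update (A k a) j₀ t)) k' (i k') j =
        ∏ k', A k' (i k') j + if j = j₀ then
          (if i k = a then (t - A k a j₀) * ∏ k' ∈ Finset.univ.erase k, A k' (i k') j₀ else 0)
          else 0 := by
    rw [← Finset.mul_prod_erase _ _ (Finset.mem_univ k),
      ← Finset.mul_prod_erase _ (fun k' => A k' (i k') j) (Finset.mem_univ k),
      Finset.prod_congr rfl (g := fun k' => A k' (i k') j) fun k' hk' => by
        rw [Function.update_of_ne (Finset.ne_of_mem_erase hk')],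
      Function.update_self]
    by_cases hi : i k = a
    · by_cases hj : j = j₀
      · subst hj
        simp only [hi, Function.update_self, if_true]
        ring
      · simp [hi, hj]
    · simp [hi]
  simp [hprod, Finset.sum_add_distrib]


/-- Entrywise form of the GCP gradient `G_k = Y₍ₖ₎ Z_k`.  Given factor matrices
`A k : Fin (n k) → Fin r → ℝ`, model entries `m(i) = ∑_j ∏_k A k (i k) j`, data
`x`, and an elementwise loss `f` such that `u ↦ f (x i) u` has derivative `g i`
at `m(i)`, the function `φ(t)` obtained from `F(A) = ∑_i f (x i) (m(i))` by
replacing the single entry `A k a j₀` with `t` has derivative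
`∑_{i : i k = a} g(i) · ∏_{k' ≠ k} A k' (i k') j₀` at `t = A k a j₀`. -/
theorem gcp_gradient_entry
    (d : ℕ) (hd : 1 ≤ d) (n : Fin d → ℕ) (hn : ∀ k, 1 ≤ n k)
    (r : ℕ) (hr : 1 ≤ r)
    (A : ∀ k : Fin d, Fin (n k) → Fin r → ℝ)
    (x : (∀ k : Fin d, Fin (n k)) → ℝ)
    (f : ℝ → ℝ → ℝ)
    (g : (∀ k : Fin d, Fin (n k)) → ℝ)
    (hf : ∀ i : ∀ k : Fin d, Fin (n k),
      HasDerivAt (fun u : ℝ => f (x i) u) (g i)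
        (∑ j : Fin r, ∏ k : Fin d, A k (i k) j))
    (k : Fin d) (a : Fin (n k)) (j₀ : Fin r) :
    HasDerivAt
      (fun t : ℝ =>
        ∑ i : ∀ k : Fin d, Fin (n k),
          f (x i)
            (∑ j : Fin r, ∏ k' : Fin d,
              Function.update A k
                (Function.update (A k) a (Function.update (A k a) j₀ t))
                k' (i k') j))
      (∑ i ∈ Finset.univ.filter fun i : ∀ k : Fin d, Fin (n k) => i k = a,
        g i * ∏ k' ∈ Finset.univ.erase k, A k' (i k') j₀)
      (A k a j₀) := by
  simp only [sum_prod_update_entry]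
  rw [Finset.sum_filter]
  refine HasDerivAt.fun_sum fun i _ => ?_
  split_ifs with hi
  · refine HasDerivAt.comp (h₂ := fun u => f (x i) u) (A k a j₀) (by simpa using hf i) ?_
    simpa using (((hasDerivAt_id (A k a j₀)).sub_const (A k a j₀)).mul_const
      (∏ k' ∈ Finset.univ.erase k, A k' (i k') j₀)).const_add
        (∑ j : Fin r, ∏ k' : Fin d, A k' (i k') j)
  · exact hasDerivAt_const _ _
end
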